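/- arXiv:1006.5831 — 5 statements merged into one kernel-verified Lean document; each statement's English description precedes it below -/
import Mathlib

section
/- Suppose (pₙ) is differentiable in quadratic mean toward p with score g. Let B : S → ℝᵖ and Y : S → ℝ be measurable with ∫ (Y² ‖B‖² + ‖B‖⁴) p dμ < ∞ and sup_n ∫ (Y² ‖B‖² + ‖B‖⁴) pₙ dμ < ∞. Suppose Σ = ∫ B Bᵀ p dμ is positive definite, and set Σₙ = ∫ B Bᵀ pₙ dμ, β* = Σ⁻¹ ∫ B Y p dμ, and βₙ* = Σₙ⁻¹ ∫ B Y pₙ dμ (matrix inverse defined to be the zero matrix when the matrix is singular). Then √n (βₙ* − β*) → Σ⁻¹ ∫ g · B (Y − ⟨B, β*⟩) p dμ as n → ∞. -/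
open MeasureTheory Matrix Filter Topology

lemma cs_aux {S : Type*} [MeasurableSpace S] {μ : Measure S} {u v : S → ℝ}
    (hu : MemLp u 2 μ) (hv : MemLp v 2 μ) :
    |∫ s, u s * v s ∂μ| ≤ Real.sqrt (∫ s, u s ^ 2 ∂μ) * Real.sqrt (∫ s, v s ^ 2 ∂μ) := by
  have h2 : (2:ENNReal) = ENNReal.ofReal 2 := by simp
  have h := integral_mul_norm_le_Lp_mul_Lq (μ := μ) (f := u) (g := v) (p := 2) (q := 2)
    ⟨by norm_num, by norm_num, by norm_num⟩ (h2 ▸ hu) (h2 ▸ hv)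
  have h1 : |∫ s, u s * v s ∂μ| ≤ ∫ s, ‖u s‖ * ‖v s‖ ∂μ := by
    have := norm_integral_le_integral_norm (μ := μ) (fun s => u s * v s)
    simpa [norm_mul] using this
  refine h1.trans (h.trans (le_of_eq ?_))
  simp [Real.sqrt_eq_rpow]

lemma im_aux {S : Type*} [MeasurableSpace S] {μ : Measure S} {u v : S → ℝ}
    (hu : MemLp u 2 μ) (hv : MemLp v 2 μ) : Integrable (fun s => u s * v s) μ :=
  hu.integrable_mul hv

lemma weak_aux {S : Type*} [MeasurableSpace S] {μ : Measure S} {h f : S → ℝ}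
    {w : ℕ → S → ℝ} (hh : MemLp h 2 μ) (hf : Measurable f)
    (hw : ∀ n, MemLp (w n) 2 μ) (hw0 : Tendsto (fun n => ∫ s, w n s ^ 2 ∂μ) atTop (𝓝 0))
    (hfw : ∀ n, MemLp (fun s => f s * w n s) 2 μ) (C : ℝ)
    (hC : ∀ n, ∫ s, (f s * w n s) ^ 2 ∂μ ≤ C) :
    Tendsto (fun n => ∫ s, h s * (f s * w n s) ∂μ) atTop (𝓝 0) := by
  set T : ℕ → Set S := fun M => {s | |f s| ≤ M} with hT
  have hTm : ∀ M, MeasurableSet (T M) := fun M => measurableSet_le hf.abs measurable_const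
  have hk : ∀ M, MemLp ((T M)ᶜ.indicator h) 2 μ := fun M => hh.indicator (hTm M).compl
  have hm : ∀ M, MemLp (fun s => f s * (T M).indicator h s) 2 μ := by
    intro M
    refine MemLp.of_le_mul (c := M) hh
      (hf.aestronglyMeasurable.mul (hh.indicator (hTm M)).aestronglyMeasurable) ?_
    refine Eventually.of_forall fun s => ?_
    by_cases hs : s ∈ T M
    · have : |f s| ≤ M := hs
      simp only [Set.indicator_of_mem hs, norm_mul, Real.norm_eq_abs]
      gcongr
    · simp only [Set.indicator_of_notMem hs]
      simp; positivity
  have hk0 : Tendsto (fun M : ℕ => ∫ s, ((T M)ᶜ.indicator h s) ^ 2 ∂μ) atTop (𝓝 0) := by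
    have := tendsto_integral_of_dominated_convergence (μ := μ)
      (F := fun M s => ((T M)ᶜ.indicator h s) ^ 2) (f := fun _ => (0:ℝ)) (fun s => h s ^ 2)
      (fun M => (hk M).integrable_sq.aestronglyMeasurable) hh.integrable_sq
      (fun M => Eventually.of_forall fun s => by
        by_cases hs : s ∈ (T M)ᶜ
        · simp [Set.indicator_of_mem hs]
        · simp [Set.indicator_of_notMem hs, sq_nonneg])
      (Eventually.of_forall fun s => by
        obtain ⟨N, hN⟩ := exists_nat_ge |f s|
        refine tendsto_const_nhds.congr' ?_
        filter_upwards [eventually_ge_atTop N] with M hM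
        have : s ∉ (T M)ᶜ := by
          simp only [hT, Set.mem_compl_iff, Set.mem_ofPred_eq, not_not]
          exact hN.trans (by exact_mod_cast hM)
        simp [Set.indicator_of_notMem this])
    simpa using this
  have hk1 : Tendsto (fun M : ℕ => Real.sqrt (∫ s, ((T M)ᶜ.indicator h s) ^ 2 ∂μ) * Real.sqrt C)
      atTop (𝓝 0) := by
    simpa using (hk0.sqrt).mul_const (Real.sqrt C)
  rw [Metric.tendsto_atTop']
  intro ε hε
  obtain ⟨M, hM⟩ := (hk1.eventually (gt_mem_nhds (half_pos hε))).exists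
  have hw1 : Tendsto (fun n : ℕ => Real.sqrt (∫ s, (f s * (T M).indicator h s) ^ 2 ∂μ) *
      Real.sqrt (∫ s, w n s ^ 2 ∂μ)) atTop (𝓝 0) := by
    simpa using (hw0.sqrt).const_mul (Real.sqrt (∫ s, (f s * (T M).indicator h s) ^ 2 ∂μ))
  obtain ⟨N, hN⟩ := eventually_atTop.1 (hw1.eventually (gt_mem_nhds (half_pos hε)))
  refine ⟨N, fun n hn => ?_⟩
  have e : ∫ s, h s * (f s * w n s) ∂μ = (∫ s, (f s * (T M).indicator h s) * w n s ∂μ) +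
      ∫ s, (T M)ᶜ.indicator h s * (f s * w n s) ∂μ := by
    rw [← integral_add (im_aux (hm M) (hw n)) (im_aux (hk M) (hfw n))]
    congr 1; ext s
    have := congrFun (Set.indicator_self_add_compl (T M) h) s
    simp only [Pi.add_apply] at this
    linear_combination (-(f s * w n s)) * this
  have b1 := cs_aux (hm M) (hw n)
  have b2 := cs_aux (hk M) (hfw n)
  have b3 := mul_le_mul_of_nonneg_left (Real.sqrt_le_sqrt (hC n))
    (Real.sqrt_nonneg (∫ s, ((T M)ᶜ.indicator h s) ^ 2 ∂μ))
  have b4 := hN n hn.le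
  rw [Real.dist_eq, sub_zero, e]
  refine (abs_add_le _ _).trans_lt ?_
  linarith

lemma int_of_lint {S : Type*} [MeasurableSpace S] {μ : Measure S} {F : S → ℝ}
    (hF : Measurable F) (h0 : ∀ s, 0 ≤ F s) (h : ∫⁻ s, ENNReal.ofReal (F s) ∂μ < ⊤) :
    Integrable F μ :=
  ⟨hF.aestronglyMeasurable, by
    rw [hasFiniteIntegral_iff_ofReal (Eventually.of_forall h0)]; exact h⟩

lemma key_aux {S : Type*} [MeasurableSpace S] (μ : Measure S)
    (p : S → ℝ) (pn : ℕ → S → ℝ) (g : S → ℝ)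
    (hp : Measurable p) (hpn : ∀ n, Measurable (pn n)) (hg : Measurable g)
    (hp0 : ∀ s, 0 ≤ p s) (hpn0 : ∀ n s, 0 ≤ pn n s)
    (hp1 : ∫ s, p s ∂μ = 1) (hpn1 : ∀ n, ∫ s, pn n s ∂μ = 1)
    (hg2 : ∫⁻ s, ENNReal.ofReal ((g s) ^ 2 * p s) ∂μ < ⊤)
    (hdqm : Tendsto
      (fun n : ℕ => ∫ s,
        (Real.sqrt n * (Real.sqrt (pn n s) - Real.sqrt (p s)) -
          (1 / 2) * g s * Real.sqrt (p s)) ^ 2 ∂μ)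
      atTop (𝓝 0))
    (f : S → ℝ) (hf : Measurable f) (F : S → ℝ) (hF : Measurable F) (hfF : ∀ s, f s ^ 2 ≤ F s)
    (hmom : ∫⁻ s, ENNReal.ofReal (F s * p s) ∂μ < ⊤)
    (hmomn : ⨆ n, ∫⁻ s, ENNReal.ofReal (F s * pn n s) ∂μ < ⊤) :
    Integrable (fun s => f s * p s) μ ∧ Integrable (fun s => g s * f s * p s) μ ∧
    Tendsto (fun n : ℕ => Real.sqrt n * ((∫ s, f s * pn n s ∂μ) - ∫ s, f s * p s ∂μ)) atTop
      (𝓝 (∫ s, g s * f s * p s ∂μ)) := by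
  have hF0 : ∀ s, 0 ≤ F s := fun s => (sq_nonneg _).trans (hfF s)
  have ip : Integrable p μ := by
    by_contra hc; rw [integral_undef hc] at hp1; norm_num at hp1
  have ipn : ∀ n, Integrable (pn n) μ := fun n => by
    by_contra hc; have := hpn1 n; rw [integral_undef hc] at this; norm_num at this
  set r : S → ℝ := fun s => Real.sqrt (p s) with hr
  set rn : ℕ → S → ℝ := fun n s => Real.sqrt (pn n s) with hrn
  have rm : Measurable r := hp.sqrt
  have rnm : ∀ n, Measurable (rn n) := fun n => (hpn n).sqrt
  have r2 : ∀ s, r s ^ 2 = p s := fun s => Real.sq_sqrt (hp0 s)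
  have rn2 : ∀ n s, rn n s ^ 2 = pn n s := fun n s => Real.sq_sqrt (hpn0 n s)
  have Lr : MemLp r 2 μ := (memLp_two_iff_integrable_sq rm.aestronglyMeasurable).2 (by simpa [r2])
  have Lrn : ∀ n, MemLp (rn n) 2 μ := fun n =>
    (memLp_two_iff_integrable_sq (rnm n).aestronglyMeasurable).2 (by simpa [rn2] using ipn n)
  have Lg : MemLp (fun s => (1/2) * g s * r s) 2 μ := by
    have : MemLp (fun s => g s * r s) 2 μ := by
      refine (memLp_two_iff_integrable_sq (hg.mul rm).aestronglyMeasurable).2 ?_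
      simp only [Pi.mul_apply, mul_pow, r2]
      exact int_of_lint ((hg.pow_const 2).mul hp) (fun s => mul_nonneg (sq_nonneg _) (hp0 s)) hg2
    simpa [mul_assoc] using this.const_mul (1/2)
  have iFp : Integrable (fun s => F s * p s) μ :=
    int_of_lint (hF.mul hp) (fun s => mul_nonneg (hF0 s) (hp0 s)) hmom
  have lFn : ∀ n, ∫⁻ s, ENNReal.ofReal (F s * pn n s) ∂μ < ⊤ := fun n =>
    (le_iSup (fun n => ∫⁻ s, ENNReal.ofReal (F s * pn n s) ∂μ) n).trans_lt hmomn
  have iFn : ∀ n, Integrable (fun s => F s * pn n s) μ := fun n =>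
    int_of_lint (hF.mul (hpn n)) (fun s => mul_nonneg (hF0 s) (hpn0 n s)) (lFn n)
  set C := (⨆ n, ∫⁻ s, ENNReal.ofReal (F s * pn n s) ∂μ).toReal with hCdef
  have hCn : ∀ n, ∫ s, F s * pn n s ∂μ ≤ C := fun n => by
    rw [integral_eq_lintegral_of_nonneg_ae
      (Eventually.of_forall fun s => mul_nonneg (hF0 s) (hpn0 n s)) (iFn n).aestronglyMeasurable]
    exact ENNReal.toReal_mono hmomn.ne
      (le_iSup (fun n => ∫⁻ s, ENNReal.ofReal (F s * pn n s) ∂μ) n)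
  have Lfr : MemLp (fun s => f s * r s) 2 μ := by
    refine (memLp_two_iff_integrable_sq (hf.mul rm).aestronglyMeasurable).2 ?_
    refine iFp.mono' ((hf.mul rm).pow_const 2).aestronglyMeasurable
      (Eventually.of_forall fun s => ?_)
    rw [Real.norm_of_nonneg (sq_nonneg _), Pi.mul_apply, mul_pow, r2]
    exact mul_le_mul_of_nonneg_right (hfF s) (hp0 s)
  have Lfrn : ∀ n, MemLp (fun s => f s * rn n s) 2 μ := fun n => by
    refine (memLp_two_iff_integrable_sq (hf.mul (rnm n)).aestronglyMeasurable).2 ?_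
    refine (iFn n).mono' ((hf.mul (rnm n)).pow_const 2).aestronglyMeasurable
      (Eventually.of_forall fun s => ?_)
    rw [Real.norm_of_nonneg (sq_nonneg _), Pi.mul_apply, mul_pow, rn2]
    exact mul_le_mul_of_nonneg_right (hfF s) (hpn0 n s)
  have i1 : Integrable (fun s => f s * p s) μ := by
    refine (Lfr.integrable_mul Lr).congr (Eventually.of_forall fun s => ?_)
    simp only [Pi.mul_apply]; rw [← r2]; ring
  have i1n : ∀ n, Integrable (fun s => f s * pn n s) μ := fun n => by
    refine ((Lfrn n).integrable_mul (Lrn n)).congr (Eventually.of_forall fun s => ?_)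
    simp only [Pi.mul_apply]; rw [← rn2]; ring
  have i2 : Integrable (fun s => g s * f s * p s) μ := by
    refine ((Lg.integrable_mul Lfr).const_mul 2).congr (Eventually.of_forall fun s => ?_)
    simp only [Pi.mul_apply]; rw [← r2]; ring
  refine ⟨i1, i2, ?_⟩
  -- bounds
  set D := 2 * C + 2 * ∫ s, F s * p s ∂μ with hD
  have bd : ∀ n (c : ℝ), c ^ 2 = 1 → ∫ s, (f s * (rn n s + c * r s)) ^ 2 ∂μ ≤ D := by
    intro n c hc
    calc ∫ s, (f s * (rn n s + c * r s)) ^ 2 ∂μ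
        ≤ ∫ s, (2 * (F s * pn n s) + 2 * (F s * p s)) ∂μ := by
          refine integral_mono_of_nonneg (Eventually.of_forall fun s => sq_nonneg _)
            (((iFn n).const_mul 2).add (iFp.const_mul 2)) (Eventually.of_forall fun s => ?_)
          have e1 : (rn n s + c * r s) ^ 2 ≤ 2 * pn n s + 2 * p s := by
            rw [← rn2, ← r2]
            have : (c * r s) ^ 2 = r s ^ 2 := by rw [mul_pow, hc, one_mul]
            nlinarith [sq_nonneg (rn n s - c * r s)]
          have : (f s * (rn n s + c * r s)) ^ 2 ≤ F s * (2 * pn n s + 2 * p s) := by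
            rw [mul_pow]
            exact mul_le_mul (hfF s) e1 (sq_nonneg _) (hF0 s)
          simp only; linarith
      _ ≤ D := by
          rw [integral_add ((iFn n).const_mul 2) (iFp.const_mul 2), integral_const_mul,
            integral_const_mul]
          linarith [hCn n]
  set h : S → ℝ := fun s => (1/2) * g s * r s with hh
  set q : ℕ → S → ℝ := fun n s => Real.sqrt n * (rn n s - r s) - h s with hq
  have Lw : ∀ n, MemLp (fun s => rn n s - r s) 2 μ := fun n => (Lrn n).sub Lr
  have Lq : ∀ n, MemLp (q n) 2 μ := fun n => ((Lw n).const_mul (Real.sqrt n)).sub Lg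
  have hq0 : Tendsto (fun n => ∫ s, q n s ^ 2 ∂μ) atTop (𝓝 0) := hdqm
  have Lfw : ∀ n, MemLp (fun s => f s * (rn n s - r s)) 2 μ := fun n => by
    simp only [mul_sub]; exact (Lfrn n).sub Lfr
  have Lfv : ∀ n, MemLp (fun s => f s * (rn n s + r s)) 2 μ := fun n => by
    simp only [mul_add]; exact (Lfrn n).add Lfr
  have hw0 : Tendsto (fun n => ∫ s, (rn n s - r s) ^ 2 ∂μ) atTop (𝓝 0) := by
    have hup : Tendsto (fun n : ℕ => (1 / (n:ℝ)) *
        (2 * (∫ s, q n s ^ 2 ∂μ) + 2 * ∫ s, h s ^ 2 ∂μ)) atTop (𝓝 0) := by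
      have := tendsto_one_div_atTop_nhds_zero_nat (𝕜 := ℝ) |>.mul
        ((hq0.const_mul 2).add_const (2 * ∫ s, h s ^ 2 ∂μ))
      simpa using this
    refine tendsto_of_tendsto_of_tendsto_of_le_of_le' tendsto_const_nhds hup
      (Eventually.of_forall fun n => integral_nonneg fun s => sq_nonneg _) ?_
    filter_upwards [eventually_gt_atTop 0] with n hn
    have hn' : (0:ℝ) < n := by exact_mod_cast hn
    rw [one_div, ← div_eq_inv_mul, le_div_iff₀ hn', ← integral_const_mul, ← integral_const_mul,
      ← integral_add ((Lq n).integrable_sq.const_mul 2) (Lg.integrable_sq.const_mul 2),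
      ← integral_mul_const]
    refine integral_mono ((Lw n).integrable_sq.mul_const _)
      (((Lq n).integrable_sq.const_mul 2).add (Lg.integrable_sq.const_mul 2)) fun s => ?_
    have e1 : (rn n s - r s) ^ 2 * n = (q n s + h s) ^ 2 := by
      have := Real.sq_sqrt hn'.le
      simp only [hq, sub_add_cancel]
      rw [mul_pow, this]; ring
    simp only
    rw [e1]
    nlinarith [sq_nonneg (q n s - h s)]
  have t2 : Tendsto (fun n => ∫ s, h s * (f s * (rn n s - r s)) ∂μ) atTop (𝓝 0) :=
    weak_aux Lg hf Lw hw0 Lfw D fun n => by simpa [sub_eq_add_neg] using bd n (-1) (by norm_num)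
  have t1 : Tendsto (fun n => ∫ s, q n s * (f s * (rn n s + r s)) ∂μ) atTop (𝓝 0) := by
    have hup : Tendsto (fun n => Real.sqrt (∫ s, q n s ^ 2 ∂μ) * Real.sqrt D) atTop (𝓝 0) := by
      simpa using hq0.sqrt.mul_const (Real.sqrt D)
    refine squeeze_zero_norm (fun n => ?_) hup
    refine (cs_aux (Lq n) (Lfv n)).trans ?_
    gcongr
    simpa using bd n 1 (by norm_num)
  have t3 := (t1.add t2).add_const (∫ s, g s * f s * p s ∂μ)
  simp only [add_zero, zero_add] at t3
  refine t3.congr fun n => ?_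
  have i3 : Integrable (fun s => q n s * (f s * (rn n s + r s)) + h s * (f s * (rn n s - r s))) μ :=
    (im_aux (Lq n) (Lfv n)).add (im_aux Lg (Lfw n))
  rw [← integral_sub (i1n n) i1, ← integral_const_mul,
    ← integral_add (im_aux (Lq n) (Lfv n)) (im_aux Lg (Lfw n)),
    ← integral_add i3 i2]
  congr 1; ext s
  simp only [hq, hh, Pi.mul_apply, Pi.add_apply]
  rw [← r2, ← rn2]; ring

lemma lim_aux {x : ℕ → ℝ} {a b : ℝ}
    (h : Tendsto (fun n : ℕ => Real.sqrt n * (x n - a)) atTop (𝓝 b)) :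
    Tendsto x atTop (𝓝 a) := by
  have hs : Tendsto (fun n : ℕ => (Real.sqrt n)⁻¹) atTop (𝓝 0) :=
    tendsto_inv_atTop_zero.comp (Real.tendsto_sqrt_atTop.comp tendsto_natCast_atTop_atTop)
  have := (hs.mul h).add_const a
  simp only [zero_mul, zero_add] at this
  refine this.congr' ?_
  filter_upwards [eventually_gt_atTop 0] with n hn
  have : Real.sqrt n ≠ 0 := by positivity
  field_simp; ring

set_option maxHeartbeats 1000000 in
/-- Under differentiability in quadratic mean of the local alternatives `pₙ` toward `p`
with score `g`, the population least-squares coefficients satisfy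
`√n (βₙ* − β*) → Σ⁻¹ ∫ g · B (Y − ⟨B, β*⟩) p dμ`. -/
theorem local_ls_coefficient_limit
    {S : Type*} [MeasurableSpace S] (μ : Measure S)
    (p : S → ℝ) (pn : ℕ → S → ℝ) (g : S → ℝ)
    (hp : Measurable p) (hpn : ∀ n, Measurable (pn n)) (hg : Measurable g)
    (hp0 : ∀ s, 0 ≤ p s) (hpn0 : ∀ n s, 0 ≤ pn n s)
    (hp1 : ∫ s, p s ∂μ = 1) (hpn1 : ∀ n, ∫ s, pn n s ∂μ = 1)
    -- ∫ g² p dμ < ∞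
    (hg2 : ∫⁻ s, ENNReal.ofReal ((g s) ^ 2 * p s) ∂μ < ⊤)
    -- differentiability in quadratic mean with score g
    (hdqm : Tendsto
      (fun n : ℕ => ∫ s,
        (Real.sqrt n * (Real.sqrt (pn n s) - Real.sqrt (p s)) -
          (1 / 2) * g s * Real.sqrt (p s)) ^ 2 ∂μ)
      atTop (𝓝 0))
    (d : ℕ) (B : S → Fin d → ℝ) (Y : S → ℝ)
    (hB : Measurable B) (hY : Measurable Y)
    -- ∫ (Y²‖B‖² + ‖B‖⁴) p dμ < ∞ and sup_n ∫ (Y²‖B‖² + ‖B‖⁴) pₙ dμ < ∞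
    (hmom : ∫⁻ s, ENNReal.ofReal
        (((Y s) ^ 2 * (B s ⬝ᵥ B s) + (B s ⬝ᵥ B s) ^ 2) * p s) ∂μ < ⊤)
    (hmomn : ⨆ n, ∫⁻ s, ENNReal.ofReal
        (((Y s) ^ 2 * (B s ⬝ᵥ B s) + (B s ⬝ᵥ B s) ^ 2) * pn n s) ∂μ < ⊤)
    (Smat : Matrix (Fin d) (Fin d) ℝ)
    (hS : Smat = Matrix.of fun j k => ∫ s, B s j * B s k * p s ∂μ)
    (hpos : Smat.PosDef)
    (Sn : ℕ → Matrix (Fin d) (Fin d) ℝ)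
    (hSn : ∀ n, Sn n = Matrix.of fun j k => ∫ s, B s j * B s k * pn n s ∂μ)
    (βstar : Fin d → ℝ)
    (hβ : βstar = Smat⁻¹ *ᵥ fun j => ∫ s, B s j * Y s * p s ∂μ)
    (βn : ℕ → Fin d → ℝ)
    (hβn : ∀ n, βn n = (Sn n)⁻¹ *ᵥ fun j => ∫ s, B s j * Y s * pn n s ∂μ) :
    Tendsto (fun n : ℕ => Real.sqrt n • (βn n - βstar)) atTop
      (𝓝 (Smat⁻¹ *ᵥ fun j => ∫ s, g s * (B s j * (Y s - B s ⬝ᵥ βstar)) * p s ∂μ)) := by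
  have hjj : ∀ s j, B s j ^ 2 ≤ B s ⬝ᵥ B s := fun s j => by
    rw [sq]; exact Finset.single_le_sum (f := fun i => B s i * B s i)
      (fun i _ => mul_self_nonneg _) (Finset.mem_univ j)
  have hBj : ∀ j, Measurable fun s => B s j := fun j => (measurable_pi_apply j).comp hB
  have hdm : Measurable fun s => B s ⬝ᵥ B s := by
    simp only [dotProduct]
    exact Finset.measurable_sum _ fun i _ => (hBj i).mul (hBj i)
  have hFm : Measurable fun s => (Y s) ^ 2 * (B s ⬝ᵥ B s) + (B s ⬝ᵥ B s) ^ 2 :=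
    ((hY.pow_const 2).mul hdm).add (hdm.pow_const 2)
  have hd0 : ∀ s, 0 ≤ B s ⬝ᵥ B s := fun s => Finset.sum_nonneg fun i _ => mul_self_nonneg _
  have K := key_aux μ p pn g hp hpn hg hp0 hpn0 hp1 hpn1 hg2 hdqm
  have KY := fun j => K (fun s => B s j * Y s) ((hBj j).mul hY) _ hFm (fun s => by
    have := mul_le_mul_of_nonneg_left (hjj s j) (sq_nonneg (Y s))
    nlinarith [sq_nonneg (B s ⬝ᵥ B s)]) hmom hmomn
  have KB := fun j k => K (fun s => B s j * B s k) ((hBj j).mul (hBj k)) _ hFm (fun s => by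
    have := mul_le_mul (hjj s j) (hjj s k) (sq_nonneg _) (hd0 s)
    nlinarith [mul_nonneg (sq_nonneg (Y s)) (hd0 s)]) hmom hmomn
  clear K
  set b : Fin d → ℝ := fun j => ∫ s, B s j * Y s * p s ∂μ with hb
  set bn : ℕ → Fin d → ℝ := fun n j => ∫ s, B s j * Y s * pn n s ∂μ with hbn
  have hdet : IsUnit Smat.det := hpos.det_pos.ne'.isUnit
  have hSlim : Tendsto Sn atTop (𝓝 Smat) := by
    refine tendsto_pi_nhds.2 fun j => tendsto_pi_nhds.2 fun k => ?_
    have := lim_aux (KB j k).2.2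
    simpa [hSn, hS] using this
  have hdlim : Tendsto (fun n => (Sn n).det) atTop (𝓝 Smat.det) :=
    (Continuous.matrix_det continuous_id).continuousAt.tendsto.comp hSlim
  have hinv : Tendsto (fun n => (Sn n)⁻¹) atTop (𝓝 Smat⁻¹) := by
    simp only [Matrix.inv_def, Ring.inverse_eq_inv']
    exact (hdlim.inv₀ hdet.ne_zero).smul
      ((Continuous.matrix_adjugate continuous_id).continuousAt.tendsto.comp hSlim)
  have hbeq : b = Smat *ᵥ βstar := by
    rw [hβ, Matrix.mulVec_mulVec, Matrix.mul_nonsing_inv _ hdet, Matrix.one_mulVec]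
  have hv : Tendsto (fun n : ℕ => fun j => Real.sqrt n * (bn n j - (Sn n *ᵥ βstar) j)) atTop
      (𝓝 (fun j => ∫ s, g s * (B s j * (Y s - B s ⬝ᵥ βstar)) * p s ∂μ)) := by
    refine tendsto_pi_nhds.2 fun j => ?_
    have h1 := (KY j).2.2.sub (tendsto_finsetSum Finset.univ
      fun k _ => (KB j k).2.2.mul_const (βstar k))
    have e : ∫ s, g s * (B s j * (Y s - B s ⬝ᵥ βstar)) * p s ∂μ =
        (∫ s, g s * (B s j * Y s) * p s ∂μ) -
          ∑ k, (∫ s, g s * (B s j * B s k) * p s ∂μ) * βstar k := by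
      simp only [← integral_mul_const]
      rw [← integral_finsetSum _ fun k _ => (KB j k).2.1.mul_const (βstar k),
        ← integral_sub (KY j).2.1 (integrable_finsetSum _ fun k _ =>
          (KB j k).2.1.mul_const (βstar k))]
      congr 1; ext s
      simp only [dotProduct, mul_sub, sub_mul, Finset.mul_sum, Finset.sum_mul]
      congr 1; exact Finset.sum_congr rfl fun k _ => by ring
    rw [e]
    refine h1.congr fun n => ?_
    have hbj : ∫ s, B s j * Y s * p s ∂μ = ∑ k, (∫ s, B s j * B s k * p s ∂μ) * βstar k := by
      have := congrFun hbeq j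
      simpa [hb, hS, Matrix.mulVec, dotProduct] using this
    rw [hbj]
    simp only [hbn, hSn, Matrix.mulVec, dotProduct, Matrix.of_apply, mul_sub, sub_mul,
      Finset.mul_sum, Finset.sum_sub_distrib, mul_assoc]
    ring
  have hlim : Tendsto (fun n : ℕ => (Sn n)⁻¹ *ᵥ
      (fun j => Real.sqrt n * (bn n j - (Sn n *ᵥ βstar) j))) atTop
      (𝓝 (Smat⁻¹ *ᵥ (fun j => ∫ s, g s * (B s j * (Y s - B s ⬝ᵥ βstar)) * p s ∂μ))) :=
    ((Continuous.matrix_mulVec continuous_fst continuous_snd).tendsto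
      (Smat⁻¹, fun j => ∫ s, g s * (B s j * (Y s - B s ⬝ᵥ βstar)) * p s ∂μ)).comp
      (hinv.prodMk_nhds hv)
  refine hlim.congr' ?_
  filter_upwards [hdlim.eventually_ne hdet.ne_zero] with n hn
  have e2 : (fun j => Real.sqrt n * (bn n j - (Sn n *ᵥ βstar) j)) =
      Real.sqrt n • (bn n - Sn n *ᵥ βstar) := by ext j; simp
  rw [e2, Matrix.mulVec_smul, Matrix.mulVec_sub, Matrix.mulVec_mulVec,
    Matrix.nonsing_inv_mul _ hn.isUnit, Matrix.one_mulVec, hβn n]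
end

section
/- Suppose (pₙ) is differentiable in quadratic mean toward p with score g. Let f : S → ℝ be measurable with ∫ f² p dμ < ∞ and sup_n ∫ f² pₙ dμ < ∞. Then √n ( ∫ f pₙ dμ − ∫ f p dμ ) → ∫ f g p dμ as n → ∞. -/
open MeasureTheory Filter Topology

lemma dqm_aux_memLp {S : Type*} [MeasurableSpace S] (μ : Measure S) (f p : S → ℝ)
    (hf : Measurable f) (hp : Measurable p) (hp0 : ∀ s, 0 ≤ p s)
    (h : ∫⁻ s, ENNReal.ofReal ((f s) ^ 2 * p s) ∂μ < ⊤) :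
    MemLp (fun s => f s * Real.sqrt (p s)) 2 μ := by
  rw [memLp_two_iff_integrable_sq (by fun_prop)]
  have e : (fun s => (f s * Real.sqrt (p s)) ^ 2) = fun s => f s ^ 2 * p s := by
    funext s
    rw [mul_pow, Real.sq_sqrt (hp0 s)]
  rw [e]
  refine ⟨by fun_prop, ?_⟩
  rw [hasFiniteIntegral_iff_ofReal]
  · exact h
  · exact Eventually.of_forall fun s => mul_nonneg (sq_nonneg _) (hp0 s)

lemma dqm_aux_cs {S : Type*} [MeasurableSpace S] (μ : Measure S) (u v : S → ℝ)
    (hu : MemLp u 2 μ) (hv : MemLp v 2 μ) :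
    (∫ s, u s * v s ∂μ) ^ 2 ≤ (∫ s, u s ^ 2 ∂μ) * ∫ s, v s ^ 2 ∂μ := by
  have h1 := hu.integrable_sq
  have h2 := hv.integrable_sq
  have h3 : Integrable (fun s => u s * v s) μ := hu.integrable_mul hv
  have key : ∀ t : ℝ, 0 ≤ (∫ s, u s ^ 2 ∂μ) * (t * t) + (2 * ∫ s, u s * v s ∂μ) * t
      + ∫ s, v s ^ 2 ∂μ := by
    intro t
    have : (∫ s, (u s * t + v s) ^ 2 ∂μ) = (∫ s, u s ^ 2 ∂μ) * (t * t)
        + (2 * ∫ s, u s * v s ∂μ) * t + ∫ s, v s ^ 2 ∂μ := by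
      have e : (fun s => (u s * t + v s) ^ 2)
          = fun s => (u s ^ 2 * (t * t) + (u s * v s) * (2 * t)) + v s ^ 2 := by
        funext s; ring
      rw [e, integral_add ((h1.mul_const _).fun_add (h3.mul_const _)) h2,
        integral_add (h1.mul_const _) (h3.mul_const _), integral_mul_const, integral_mul_const]
      ring
    rw [← this]
    exact integral_nonneg fun s => sq_nonneg _
  have := discrim_le_zero key
  unfold discrim at this
  nlinarith

lemma dqm_aux_lim {S : Type*} [MeasurableSpace S] (μ : Measure S) (u v : ℕ → S → ℝ)
    (hu : ∀ n, MemLp (u n) 2 μ) (hv : ∀ n, MemLp (v n) 2 μ)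
    (hu0 : Tendsto (fun n => ∫ s, u n s ^ 2 ∂μ) atTop (𝓝 0))
    (C : ℝ) (hC : ∀ n, ∫ s, v n s ^ 2 ∂μ ≤ C) :
    Tendsto (fun n => ∫ s, u n s * v n s ∂μ) atTop (𝓝 0) := by
  have h2 : Tendsto (fun n => (∫ s, u n s * v n s ∂μ) ^ 2) atTop (𝓝 0) := by
    refine squeeze_zero (g := fun n => (∫ s, u n s ^ 2 ∂μ) * C) (fun n => sq_nonneg _)
      (fun n => ?_) (by simpa using hu0.mul_const C)
    exact (dqm_aux_cs μ _ _ (hu n) (hv n)).trans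
      (mul_le_mul_of_nonneg_left (hC n) (integral_nonneg fun s => sq_nonneg _))
  have h3 := h2.sqrt
  simp only [Real.sqrt_sq_eq_abs, Real.sqrt_zero] at h3
  exact (tendsto_zero_iff_abs_tendsto_zero _).2 h3

lemma dqm_aux_dct {S : Type*} [MeasurableSpace S] (μ : Measure S) (h : S → ℝ) (w : ℕ → S → ℝ)
    (hh : MemLp h 2 μ) (hw : ∀ n, Measurable (w n)) (hw1 : ∀ n s, |w n s| ≤ 1)
    (hw0 : ∀ s, Tendsto (fun n => w n s) atTop (𝓝 0)) :
    (∀ n, MemLp (fun s => h s * w n s) 2 μ) ∧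
    Tendsto (fun n => ∫ s, (h s * w n s) ^ 2 ∂μ) atTop (𝓝 0) := by
  have hm : ∀ n, AEStronglyMeasurable (fun s => h s * w n s) μ := fun n =>
    hh.1.mul (hw n).aestronglyMeasurable
  constructor
  · intro n
    refine hh.mono (hm n) (Eventually.of_forall fun s => ?_)
    rw [Real.norm_eq_abs, Real.norm_eq_abs, abs_mul]
    exact mul_le_of_le_one_right (abs_nonneg _) (hw1 n s)
  · have := tendsto_integral_of_dominated_convergence (μ := μ)
      (F := fun n s => (h s * w n s) ^ 2) (f := fun _ => (0:ℝ)) (fun s => h s ^ 2)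
      (fun n => (hm n).pow 2) hh.integrable_sq
      (fun n => Eventually.of_forall fun s => ?_)
      (Eventually.of_forall fun s => ?_)
    · simpa using this
    · rw [Real.norm_eq_abs, abs_of_nonneg (sq_nonneg _), mul_pow]
      exact mul_le_of_le_one_right (sq_nonneg _) ((sq_le_one_iff_abs_le_one _).2 (hw1 n s))
    · simpa using ((hw0 s).const_mul (h s)).pow 2

lemma dqm_aux_sq_add {S : Type*} [MeasurableSpace S] (μ : Measure S) (u v : S → ℝ)
    (hu : MemLp u 2 μ) (hv : MemLp v 2 μ) :
    (∫ s, (u s + v s) ^ 2 ∂μ) ≤ 2 * (∫ s, u s ^ 2 ∂μ) + 2 * ∫ s, v s ^ 2 ∂μ := by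
  rw [← integral_const_mul, ← integral_const_mul,
    ← integral_add (hu.integrable_sq.const_mul 2) (hv.integrable_sq.const_mul 2)]
  refine integral_mono (hu.add hv).integrable_sq
    ((hu.integrable_sq.const_mul 2).add (hv.integrable_sq.const_mul 2)) fun s => ?_
  simp only
  nlinarith [sq_nonneg (u s - v s)]

/-- Under differentiability in quadratic mean with score `g`, for square-integrable `f`
(uniformly under the `pₙ`), `√n (∫ f pₙ dμ − ∫ f p dμ) → ∫ f g p dμ`. -/
theorem dqm_linear_functional_limit
    {S : Type*} [MeasurableSpace S] (μ : Measure S)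
    (p : S → ℝ) (pn : ℕ → S → ℝ) (g : S → ℝ)
    (hp : Measurable p) (hpn : ∀ n, Measurable (pn n)) (hg : Measurable g)
    (hp0 : ∀ s, 0 ≤ p s) (hpn0 : ∀ n s, 0 ≤ pn n s)
    (hp1 : ∫ s, p s ∂μ = 1) (hpn1 : ∀ n, ∫ s, pn n s ∂μ = 1)
    -- ∫ g² p dμ < ∞
    (hg2 : ∫⁻ s, ENNReal.ofReal ((g s) ^ 2 * p s) ∂μ < ⊤)
    -- differentiability in quadratic mean with score g
    (hdqm : Tendsto
      (fun n : ℕ => ∫ s,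
        (Real.sqrt n * (Real.sqrt (pn n s) - Real.sqrt (p s)) -
          (1 / 2) * g s * Real.sqrt (p s)) ^ 2 ∂μ)
      atTop (𝓝 0))
    (f : S → ℝ) (hf : Measurable f)
    -- ∫ f² p dμ < ∞ and sup_n ∫ f² pₙ dμ < ∞
    (hf2 : ∫⁻ s, ENNReal.ofReal ((f s) ^ 2 * p s) ∂μ < ⊤)
    (hf2n : ⨆ n, ∫⁻ s, ENNReal.ofReal ((f s) ^ 2 * pn n s) ∂μ < ⊤) :
    Tendsto
      (fun n : ℕ => Real.sqrt n * ((∫ s, f s * pn n s ∂μ) - ∫ s, f s * p s ∂μ))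
      atTop (𝓝 (∫ s, f s * g s * p s ∂μ)) := by
  have hb : ∀ n, ∫⁻ s, ENNReal.ofReal ((f s) ^ 2 * pn n s) ∂μ ≤
    ⨆ n, ∫⁻ s, ENNReal.ofReal ((f s) ^ 2 * pn n s) ∂μ := fun n =>
      le_iSup (fun n => ∫⁻ s, ENNReal.ofReal ((f s) ^ 2 * pn n s) ∂μ) n
  have hga := dqm_aux_memLp μ g p hg hp hp0 hg2
  have hfa := dqm_aux_memLp μ f p hf hp hp0 hf2
  have hfan : ∀ n, MemLp (fun s => f s * √(pn n s)) 2 μ := fun n =>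
    dqm_aux_memLp μ f (pn n) hf (hpn n) (hpn0 n) ((hb n).trans_lt hf2n)
  have hsq : ∀ q : S → ℝ, Measurable q → (∀ s, 0 ≤ q s) → ∫ s, q s ∂μ = 1 →
      MemLp (fun s => √(q s)) 2 μ := by
    intro q hq hq0 hq1
    rw [memLp_two_iff_integrable_sq (by fun_prop)]
    simp only [Real.sq_sqrt (hq0 _)]
    exact integrable_of_integral_eq_one hq1
  have ha := hsq p hp hp0 hp1
  have han := fun n => hsq (pn n) (hpn n) (hpn0 n) (hpn1 n)
  obtain ⟨C, hC⟩ : ∃ C : ℝ, ∀ n, ∫ s, (f s * √(pn n s)) ^ 2 ∂μ ≤ C := by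
    refine ⟨(⨆ n, ∫⁻ s, ENNReal.ofReal ((f s) ^ 2 * pn n s) ∂μ).toReal, fun n => ?_⟩
    rw [integral_eq_lintegral_of_nonneg_ae (Eventually.of_forall fun s => sq_nonneg _)
      (by have := hpn n; fun_prop)]
    simp only [mul_pow, Real.sq_sqrt (hpn0 n _)]
    exact ENNReal.toReal_mono hf2n.ne (hb n)
  set D : ℕ → S → ℝ := fun n s => √n * (√(pn n s) - √(p s)) - (1 / 2) * g s * √(p s) with hD
  have hDm : ∀ n, MemLp (D n) 2 μ := by
    intro n
    have := (((han n).sub ha).const_mul (√n)).sub (hga.const_mul (1/2))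
    refine this.ae_eq (Eventually.of_forall fun s => ?_)
    simp [hD]
    ring
  obtain ⟨B, hB⟩ := hdqm.bddAbove_range
  have hB' : ∀ n, ∫ s, D n s ^ 2 ∂μ ≤ B := fun n => hB ⟨n, rfl⟩
  -- weights
  let φ : ℕ → S → ℝ := fun n s => if (n : ℝ) < f s ^ 2 then 1 else 0
  let ψ : ℕ → S → ℝ := fun n s => if (n : ℝ) < f s ^ 2 then 0 else f s / √n
  have hms : ∀ n : ℕ, MeasurableSet {s | (n : ℝ) < f s ^ 2} := fun n =>
    measurableSet_lt measurable_const (hf.pow_const 2)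
  have hev : ∀ s, ∀ᶠ n : ℕ in atTop, ¬ (n : ℝ) < f s ^ 2 := by
    intro s
    filter_upwards [tendsto_natCast_atTop_atTop.eventually_ge_atTop (f s ^ 2)] with n hn
    exact not_lt.2 hn
  obtain ⟨hφm, hφ0⟩ := dqm_aux_dct μ _ φ hga
    (fun n => Measurable.ite (hms n) measurable_const measurable_const)
    (fun n s => by simp only [φ]; split_ifs <;> simp)
    (fun s => by
      refine tendsto_const_nhds.congr' ?_
      filter_upwards [hev s] with n hn
      simp [φ, hn])
  obtain ⟨hψm, hψ0⟩ := dqm_aux_dct μ _ ψ hga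
    (fun n => Measurable.ite (hms n) measurable_const (hf.div_const _))
    (fun n s => by
      simp only [ψ]
      split_ifs with h
      · simp
      · rw [abs_div, abs_of_nonneg (Real.sqrt_nonneg _)]
        exact div_le_one_of_le₀ (Real.abs_le_sqrt (not_lt.1 h)) (Real.sqrt_nonneg _))
    (fun s => by
      have : Tendsto (fun n : ℕ => f s / √n) atTop (𝓝 0) :=
        (Real.tendsto_sqrt_atTop.comp tendsto_natCast_atTop_atTop).const_div_atTop (f s)
      refine this.congr' ?_
      filter_upwards [hev s] with n hn
      simp [ψ, hn])
  have hplus : ∀ n, MemLp (fun s => f s * √(pn n s) + f s * √(p s)) 2 μ :=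
    fun n => (hfan n).add hfa
  have hminus : ∀ n, MemLp (fun s => f s * √(pn n s) + (-1) * (f s * √(p s))) 2 μ :=
    fun n => (hfan n).add (hfa.const_mul (-1))
  have hDh : ∀ n, MemLp (fun s => D n s + (1 / 2) * (g s * √(p s))) 2 μ :=
    fun n => (hDm n).add (hga.const_mul (1 / 2))
  have L1 := dqm_aux_lim μ D _ hDm hplus hdqm _ (fun n =>
    (dqm_aux_sq_add μ _ _ (hfan n) hfa).trans
      (add_le_add (mul_le_mul_of_nonneg_left (hC n) zero_le_two) le_rfl))
  have L2 := dqm_aux_lim μ _ _ hφm hminus hφ0 _ (fun n =>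
    (dqm_aux_sq_add μ _ _ (hfan n) (hfa.const_mul (-1))).trans
      (add_le_add (mul_le_mul_of_nonneg_left (hC n) zero_le_two) le_rfl))
  have L3 := dqm_aux_lim μ _ _ hψm hDh hψ0 _ (fun n =>
    (dqm_aux_sq_add μ _ _ (hDm n) (hga.const_mul (1 / 2))).trans
      (add_le_add (mul_le_mul_of_nonneg_left (hB' n) zero_le_two) le_rfl))
  have L := ((L1.add (L2.const_mul (1 / 2))).add (L3.const_mul (1 / 2))).add_const
    (∫ s, f s * g s * p s ∂μ)
  simp only [mul_zero, add_zero, zero_add] at L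
  refine L.congr' ?_
  filter_upwards [eventually_gt_atTop 0] with n hn
  have hn' : (0 : ℝ) < √n := Real.sqrt_pos.2 (by exact_mod_cast hn)
  have I1 : Integrable (fun s => D n s * (f s * √(pn n s) + f s * √(p s))) μ :=
    (hDm n).integrable_mul (hplus n)
  have I2 : Integrable (fun s => g s * √(p s) * φ n s *
      (f s * √(pn n s) + (-1) * (f s * √(p s)))) μ := (hφm n).integrable_mul (hminus n)
  have I3 : Integrable (fun s => g s * √(p s) * ψ n s *
      (D n s + (1 / 2) * (g s * √(p s)))) μ := (hψm n).integrable_mul (hDh n)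
  have I4 : Integrable (fun s => f s * g s * p s) μ := by
    refine (hfa.integrable_mul hga).congr (Eventually.of_forall fun s => ?_)
    simp only [Pi.mul_apply]
    linear_combination (f s * g s) * Real.mul_self_sqrt (hp0 s)
  have I5 : Integrable (fun s => f s * p s) μ := by
    refine (hfa.integrable_mul ha).congr (Eventually.of_forall fun s => ?_)
    simp only [Pi.mul_apply]
    linear_combination (f s) * Real.mul_self_sqrt (hp0 s)
  have I6 : Integrable (fun s => f s * pn n s) μ := by
    refine ((hfan n).integrable_mul (han n)).congr (Eventually.of_forall fun s => ?_)
    simp only [Pi.mul_apply]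
    linear_combination (f s) * Real.mul_self_sqrt (hpn0 n s)
  rw [← integral_sub I6 I5, ← integral_const_mul, ← integral_const_mul, ← integral_const_mul,
    ← integral_add I1 (I2.const_mul _), ← integral_add (I1.fun_add (I2.const_mul _)) (I3.const_mul _),
    ← integral_add ((I1.fun_add (I2.const_mul _)).fun_add (I3.const_mul _)) I4]
  refine integral_congr_ae (Eventually.of_forall fun s => ?_)
  have e1 := Real.mul_self_sqrt (hp0 s)
  have e2 := Real.mul_self_sqrt (hpn0 n s)
  simp only [φ, ψ, hD]
  generalize √(p s) = a at *
  generalize √(pn n s) = b at *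
  rw [← e1, ← e2]
  split_ifs
  · ring
  · field_simp
    ring
end

section
/- Suppose (pₙ) is differentiable in quadratic mean toward p with score g. Let ν : S → ℝ be measurable with ∫ ν² p dμ < ∞ and sup_n ∫ ν² pₙ dμ < ∞. Then ∫ ν pₙ dμ → ∫ ν p dμ as n → ∞. -/
open MeasureTheory Filter Topology

/-- Under differentiability in quadratic mean with score `g`, for square-integrable `ν`
(uniformly under the `pₙ`), `∫ ν pₙ dμ → ∫ ν p dμ`. -/
theorem dqm_mean_convergence
    {S : Type*} [MeasurableSpace S] (μ : Measure S)
    (p : S → ℝ) (pn : ℕ → S → ℝ) (g : S → ℝ)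
    (hp : Measurable p) (hpn : ∀ n, Measurable (pn n)) (hg : Measurable g)
    (hp0 : ∀ s, 0 ≤ p s) (hpn0 : ∀ n s, 0 ≤ pn n s)
    (hp1 : ∫ s, p s ∂μ = 1) (hpn1 : ∀ n, ∫ s, pn n s ∂μ = 1)
    -- ∫ g² p dμ < ∞
    (hg2 : ∫⁻ s, ENNReal.ofReal ((g s) ^ 2 * p s) ∂μ < ⊤)
    -- differentiability in quadratic mean with score g
    (hdqm : Tendsto
      (fun n : ℕ => ∫ s,
        (Real.sqrt n * (Real.sqrt (pn n s) - Real.sqrt (p s)) -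
          (1 / 2) * g s * Real.sqrt (p s)) ^ 2 ∂μ)
      atTop (𝓝 0))
    (ν : S → ℝ) (hν : Measurable ν)
    -- ∫ ν² p dμ < ∞ and sup_n ∫ ν² pₙ dμ < ∞
    (hν2 : ∫⁻ s, ENNReal.ofReal ((ν s) ^ 2 * p s) ∂μ < ⊤)
    (hν2n : ⨆ n, ∫⁻ s, ENNReal.ofReal ((ν s) ^ 2 * pn n s) ∂μ < ⊤) :
    Tendsto (fun n : ℕ => ∫ s, ν s * pn n s ∂μ) atTop (𝓝 (∫ s, ν s * p s ∂μ)) := by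
  have hp_i : Integrable p μ := by
    by_contra h
    rw [integral_undef h] at hp1
    exact zero_ne_one hp1
  have hpn_i : ∀ n, Integrable (pn n) μ := by
    intro n
    by_contra h
    have := hpn1 n
    rw [integral_undef h] at this
    exact zero_ne_one this
  have key : ∀ f q : S → ℝ, Measurable f → Measurable q → (∀ s, 0 ≤ q s) →
      ∫⁻ s, ENNReal.ofReal ((f s) ^ 2 * q s) ∂μ < ⊤ →
      Integrable (fun s => (f s) ^ 2 * q s) μ := by
    intro f q hf hq hq0 h
    refine ⟨((hf.pow_const 2).mul hq).aestronglyMeasurable, ?_⟩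
    rw [hasFiniteIntegral_iff_ofReal (ae_of_all _ fun s => mul_nonneg (sq_nonneg _) (hq0 s))]
    exact h
  have hg_i := key g p hg hp hp0 hg2
  have hν_i := key ν p hν hp hp0 hν2
  have hle : ∀ n, ∫⁻ s, ENNReal.ofReal ((ν s) ^ 2 * pn n s) ∂μ ≤
      ⨆ n, ∫⁻ s, ENNReal.ofReal ((ν s) ^ 2 * pn n s) ∂μ := fun n =>
    le_iSup (fun n => ∫⁻ s, ENNReal.ofReal ((ν s) ^ 2 * pn n s) ∂μ) n
  have hνn_i := fun n => key ν (pn n) hν (hpn n) (hpn0 n) ((hle n).trans_lt hν2n)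
  obtain ⟨M, hM⟩ : ∃ M : ℝ, ∀ n, ∫ s, (ν s) ^ 2 * pn n s ∂μ ≤ M := by
    refine ⟨(⨆ n, ∫⁻ s, ENNReal.ofReal ((ν s) ^ 2 * pn n s) ∂μ).toReal, fun n => ?_⟩
    rw [integral_eq_lintegral_of_nonneg_ae
      (ae_of_all _ fun s => mul_nonneg (sq_nonneg _) (hpn0 n s)) (hνn_i n).aestronglyMeasurable]
    exact ENNReal.toReal_mono hν2n.ne (hle n)
  have hprod : ∀ q : S → ℝ, Measurable q → (∀ s, 0 ≤ q s) → Integrable q μ →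
      Integrable (fun s => (ν s) ^ 2 * q s) μ → Integrable (fun s => ν s * q s) μ := by
    intro q hq hq0 h1 h2
    refine (h1.add h2).mono' (hν.mul hq).aestronglyMeasurable (ae_of_all _ fun s => ?_)
    simp only [Pi.add_apply, Real.norm_eq_abs, abs_mul, abs_of_nonneg (hq0 s)]
    nlinarith [hq0 s, sq_abs (ν s), mul_nonneg (hq0 s) (sq_nonneg (|ν s| - 1)),
      mul_nonneg (hq0 s) (sq_nonneg (ν s))]
  have hA_i : ∀ n : ℕ, Integrable (fun s => (Real.sqrt n * (Real.sqrt (pn n s) - Real.sqrt (p s)) -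
          (1 / 2) * g s * Real.sqrt (p s)) ^ 2) μ := by
    intro n
    refine ((((hpn_i n).const_mul (3 * n : ℝ)).add (hp_i.const_mul (3 * n : ℝ))).add
      (hg_i.const_mul 3)).mono' ?_ (ae_of_all _ fun s => ?_)
    · exact Measurable.aestronglyMeasurable (by fun_prop)
    · simp only [Pi.add_apply, Real.norm_eq_abs, abs_sq]
      have h1 := Real.sq_sqrt (hpn0 n s)
      have h2 := Real.sq_sqrt (hp0 s)
      have h3 := Real.sq_sqrt (Nat.cast_nonneg (α := ℝ) n)
      generalize Real.sqrt (pn n s) = a at *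
      generalize Real.sqrt (p s) = b at *
      generalize Real.sqrt (n : ℝ) = c at *
      rw [← h1, ← h2, ← h3]
      nlinarith [sq_nonneg (c * a + c * b), sq_nonneg (c * a + 1 / 2 * g s * b),
        sq_nonneg (c * b - 1 / 2 * g s * b), sq_nonneg (g s * b)]
  have hsq : Tendsto (fun n : ℕ => Real.sqrt n) atTop atTop :=
    Real.tendsto_sqrt_atTop.comp tendsto_natCast_atTop_atTop
  rw [tendsto_iff_norm_sub_tendsto_zero]
  have hlim : Tendsto (fun n : ℕ => (Real.sqrt n)⁻¹ * (M + ∫ s, (ν s) ^ 2 * p s ∂μ +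
      (∫ s, (Real.sqrt n * (Real.sqrt (pn n s) - Real.sqrt (p s)) -
          (1 / 2) * g s * Real.sqrt (p s)) ^ 2 ∂μ) + ∫ s, (g s) ^ 2 * p s ∂μ)) atTop (𝓝 0) := by
    have := hsq.inv_tendsto_atTop.mul
      ((hdqm.const_add (M + ∫ s, (ν s) ^ 2 * p s ∂μ)).add_const (∫ s, (g s) ^ 2 * p s ∂μ))
    simpa using this
  refine squeeze_zero' (Eventually.of_forall fun n => norm_nonneg _) ?_ hlim
  filter_upwards [eventually_gt_atTop 0] with n hn
  have hc : 0 < Real.sqrt (n : ℝ) := Real.sqrt_pos.mpr (by exact_mod_cast hn)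
  rw [← integral_sub (hprod _ (hpn n) (hpn0 n) (hpn_i n) (hνn_i n)) (hprod _ hp hp0 hp_i hν_i)]
  have hB := (((hνn_i n).add hν_i).add (hA_i n)).add hg_i
  refine (norm_integral_le_of_norm_le (hB.const_mul (Real.sqrt (n : ℝ))⁻¹)
    (ae_of_all _ fun s => ?_)).trans ?_
  · simp only [Pi.add_apply, Real.norm_eq_abs]
    rw [inv_mul_eq_div, le_div_iff₀ hc]
    have h1 := Real.sq_sqrt (hpn0 n s)
    have h2 := Real.sq_sqrt (hp0 s)
    generalize Real.sqrt (pn n s) = a at *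
    generalize Real.sqrt (p s) = b at *
    generalize Real.sqrt (n : ℝ) = c at *
    rw [← h1, ← h2, ← abs_of_pos hc, ← abs_mul, abs_of_pos hc]
    obtain ⟨A, hA⟩ : ∃ A, A = c * (a - b) - 1 / 2 * g s * b := ⟨_, rfl⟩
    have e : (ν s * a ^ 2 - ν s * b ^ 2) * c = (ν s * (a + b)) * (A + 1 / 2 * g s * b) := by
      rw [hA]; ring
    rw [e, ← hA, abs_le]
    constructor
    · nlinarith [sq_nonneg (ν s * (a + b) + (A + 1 / 2 * g s * b)), sq_nonneg (ν s * (a - b)),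
        sq_nonneg (A - 1 / 2 * g s * b), sq_nonneg (g s * b)]
    · nlinarith [sq_nonneg (ν s * (a + b) - (A + 1 / 2 * g s * b)), sq_nonneg (ν s * (a - b)),
        sq_nonneg (A - 1 / 2 * g s * b), sq_nonneg (g s * b)]
  · rw [integral_const_mul, integral_add' (((hνn_i n).add hν_i).add (hA_i n)) hg_i,
      integral_add' ((hνn_i n).add hν_i) (hA_i n), integral_add' (hνn_i n) hν_i]
    have := hM n
    gcongr
end

section
/- Let q and p be nonnegative measurable functions on S with ∫ q dμ = ∫ p dμ = 1, and let ν : S → ℝ be measurable with ∫ ν² q dμ < ∞ and ∫ ν² p dμ < ∞. Then | ∫ ν (q − p) dμ | ≤ √( 2 ∫ ν² q dμ + 2 ∫ ν² p dμ ) · √( ∫ (√q − √p)² dμ ). -/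
open MeasureTheory

/-- Hellinger-type bound: for probability densities `q, p` and square-integrable `ν`,
`|∫ ν (q − p) dμ| ≤ √(2∫ν²q + 2∫ν²p) · √(∫(√q − √p)² dμ)`. -/
theorem hellinger_mean_difference_bound
    {S : Type*} [MeasurableSpace S] (μ : Measure S)
    (q p : S → ℝ) (hq : Measurable q) (hp : Measurable p)
    (hq0 : ∀ s, 0 ≤ q s) (hp0 : ∀ s, 0 ≤ p s)
    (hq1 : ∫ s, q s ∂μ = 1) (hp1 : ∫ s, p s ∂μ = 1)
    (ν : S → ℝ) (hν : Measurable ν)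
    (hνq : Integrable (fun s => (ν s) ^ 2 * q s) μ)
    (hνp : Integrable (fun s => (ν s) ^ 2 * p s) μ) :
    |∫ s, ν s * (q s - p s) ∂μ| ≤
      Real.sqrt (2 * (∫ s, (ν s) ^ 2 * q s ∂μ) + 2 * ∫ s, (ν s) ^ 2 * p s ∂μ) *
        Real.sqrt (∫ s, (Real.sqrt (q s) - Real.sqrt (p s)) ^ 2 ∂μ) := by
  have iq : Integrable q μ := by
    by_contra h
    rw [integral_undef h] at hq1
    norm_num at hq1
  have ip : Integrable p μ := by
    by_contra h
    rw [integral_undef h] at hp1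
    norm_num at hp1
  have hi1 : Integrable (fun s => 2 * ((ν s) ^ 2 * q s) + 2 * ((ν s) ^ 2 * p s)) μ :=
    (hνq.const_mul 2).add (hνp.const_mul 2)
  have hb : ∀ s, (ν s * (√(q s) + √(p s))) ^ 2
      ≤ 2 * ((ν s) ^ 2 * q s) + 2 * ((ν s) ^ 2 * p s) := by
    intro s
    have h1 := Real.sq_sqrt (hq0 s)
    have h2 := Real.sq_sqrt (hp0 s)
    have h3 := sq_nonneg (ν s * (√(q s) - √(p s)))
    have e : 2 * ((ν s) ^ 2 * q s) + 2 * ((ν s) ^ 2 * p s)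
        = 2 * ((ν s) ^ 2 * √(q s) ^ 2) + 2 * ((ν s) ^ 2 * √(p s) ^ 2) := by rw [h1, h2]
    rw [e]
    nlinarith
  have mf : Measurable (fun s => ν s * (√(q s) + √(p s))) :=
    hν.mul (hq.sqrt.add hp.sqrt)
  have mg : Measurable (fun s => √(q s) - √(p s)) := hq.sqrt.sub hp.sqrt
  have jf : Integrable (fun s => (ν s * (√(q s) + √(p s))) ^ 2) μ := by
    refine hi1.mono' (mf.pow_const 2).aestronglyMeasurable (Filter.Eventually.of_forall fun s => ?_)
    rw [Real.norm_of_nonneg (sq_nonneg _)]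
    exact hb s
  have jg : Integrable (fun s => (√(q s) - √(p s)) ^ 2) μ := by
    refine (iq.add ip).mono' (mg.pow_const 2).aestronglyMeasurable
      (Filter.Eventually.of_forall fun s => ?_)
    rw [Real.norm_of_nonneg (sq_nonneg _)]
    have h1 := Real.sq_sqrt (hq0 s)
    have h2 := Real.sq_sqrt (hp0 s)
    have h3 := mul_nonneg (Real.sqrt_nonneg (q s)) (Real.sqrt_nonneg (p s))
    simp only [Pi.add_apply]
    nlinarith
  have Lf := (memLp_two_iff_integrable_sq mf.aestronglyMeasurable).2 jf
  have Lg := (memLp_two_iff_integrable_sq mg.aestronglyMeasurable).2 jg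
  have H := integral_mul_norm_le_Lp_mul_Lq (μ := μ) Real.HolderConjugate.two_two
    (by simpa using Lf) (by simpa using Lg)
  simp only [Real.rpow_two, Real.norm_eq_abs, sq_abs, ← Real.sqrt_eq_rpow] at H
  have e1 : ∫ s, ν s * (q s - p s) ∂μ
      = ∫ s, (ν s * (√(q s) + √(p s))) * (√(q s) - √(p s)) ∂μ := by
    congr 1
    ext s
    have h1 := Real.sq_sqrt (hq0 s)
    have h2 := Real.sq_sqrt (hp0 s)
    linear_combination (-ν s) * h1 + ν s * h2
  rw [e1]
  refine (abs_integral_le_integral_abs).trans ?_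
  simp only [abs_mul _ (√(q _) - √(p _))]
  refine H.trans ?_
  gcongr
  rw [← integral_const_mul, ← integral_const_mul,
    ← integral_add (hνq.const_mul 2) (hνp.const_mul 2)]
  exact integral_mono jf hi1 hb
end

section
/- Suppose (pₙ) is differentiable in quadratic mean toward p with score g. Let B : S → ℝᵖ be measurable with ∫ ‖B‖⁴ p dμ < ∞ and sup_n ∫ ‖B‖⁴ pₙ dμ < ∞. Then the Gram matrices converge: ∫ B Bᵀ pₙ dμ → ∫ B Bᵀ p dμ entrywise as n → ∞. -/
open MeasureTheory Matrix Filter Topology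

/-- Under differentiability in quadratic mean with score `g`, if `∫‖B‖⁴ p dμ < ∞` and
`sup_n ∫‖B‖⁴ pₙ dμ < ∞`, the Gram matrices converge entrywise:
`∫ B Bᵀ pₙ dμ → ∫ B Bᵀ p dμ`. -/
theorem dqm_gram_convergence
    {S : Type*} [MeasurableSpace S] (μ : Measure S)
    (p : S → ℝ) (pn : ℕ → S → ℝ) (g : S → ℝ)
    (hp : Measurable p) (hpn : ∀ n, Measurable (pn n)) (hg : Measurable g)
    (hp0 : ∀ s, 0 ≤ p s) (hpn0 : ∀ n s, 0 ≤ pn n s)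
    (hp1 : ∫ s, p s ∂μ = 1) (hpn1 : ∀ n, ∫ s, pn n s ∂μ = 1)
    -- ∫ g² p dμ < ∞
    (hg2 : ∫⁻ s, ENNReal.ofReal ((g s) ^ 2 * p s) ∂μ < ⊤)
    -- differentiability in quadratic mean with score g
    (hdqm : Tendsto
      (fun n : ℕ => ∫ s,
        (Real.sqrt n * (Real.sqrt (pn n s) - Real.sqrt (p s)) -
          (1 / 2) * g s * Real.sqrt (p s)) ^ 2 ∂μ)
      atTop (𝓝 0))
    (d : ℕ) (B : S → Fin d → ℝ) (hB : Measurable B)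
    -- ∫ ‖B‖⁴ p dμ < ∞ and sup_n ∫ ‖B‖⁴ pₙ dμ < ∞  (‖B‖² = B ⬝ᵥ B)
    (hB4 : ∫⁻ s, ENNReal.ofReal ((B s ⬝ᵥ B s) ^ 2 * p s) ∂μ < ⊤)
    (hB4n : ⨆ n, ∫⁻ s, ENNReal.ofReal ((B s ⬝ᵥ B s) ^ 2 * pn n s) ∂μ < ⊤) :
    ∀ j k : Fin d,
      Tendsto (fun n : ℕ => ∫ s, B s j * B s k * pn n s ∂μ) atTop
        (𝓝 (∫ s, B s j * B s k * p s ∂μ)) := by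
  intro j k
  have toInt : ∀ f : S → ℝ, Measurable f → (∀ s, 0 ≤ f s) →
      (∫⁻ s, ENNReal.ofReal (f s) ∂μ < ⊤) → Integrable f μ := by
    intro f hf h0 hlt
    exact (lintegral_ofReal_ne_top_iff_integrable hf.aestronglyMeasurable
      (Eventually.of_forall h0)).1 hlt.ne
  have hBj : ∀ i, Measurable fun s => B s i := fun i => (measurable_pi_apply i).comp hB
  have hBB : Measurable fun s => B s ⬝ᵥ B s := by
    unfold dotProduct
    exact Finset.measurable_sum _ fun i _ => (hBj i).mul (hBj i)
  have ip : Integrable p μ := by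
    by_contra h
    rw [integral_undef h] at hp1
    norm_num at hp1
  have ipn : ∀ n, Integrable (pn n) μ := by
    intro n
    by_contra h
    have := hpn1 n
    rw [integral_undef h] at this
    norm_num at this
  have ig : Integrable (fun s => (g s) ^ 2 * p s) μ :=
    toInt _ ((hg.pow_const 2).mul hp) (fun s => mul_nonneg (sq_nonneg _) (hp0 s)) hg2
  have iB : Integrable (fun s => (B s ⬝ᵥ B s) ^ 2 * p s) μ :=
    toInt _ ((hBB.pow_const 2).mul hp) (fun s => mul_nonneg (sq_nonneg _) (hp0 s)) hB4
  have hBle : ∀ n, ∫⁻ s, ENNReal.ofReal ((B s ⬝ᵥ B s) ^ 2 * pn n s) ∂μ ≤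
      ⨆ n, ∫⁻ s, ENNReal.ofReal ((B s ⬝ᵥ B s) ^ 2 * pn n s) ∂μ := fun n =>
    le_iSup (fun n => ∫⁻ s, ENNReal.ofReal ((B s ⬝ᵥ B s) ^ 2 * pn n s) ∂μ) n
  have iBn : ∀ n, Integrable (fun s => (B s ⬝ᵥ B s) ^ 2 * pn n s) μ := fun n =>
    toInt _ ((hBB.pow_const 2).mul (hpn n)) (fun s => mul_nonneg (sq_nonneg _) (hpn0 n s))
      ((hBle n).trans_lt hB4n)
  obtain ⟨M, hM⟩ : ∃ M : ℝ, ∀ n, ∫ s, (B s ⬝ᵥ B s) ^ 2 * pn n s ∂μ ≤ M := by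
    refine ⟨(⨆ n, ∫⁻ s, ENNReal.ofReal ((B s ⬝ᵥ B s) ^ 2 * pn n s) ∂μ).toReal, fun n => ?_⟩
    rw [integral_eq_lintegral_of_nonneg_ae
      (Eventually.of_forall fun s => mul_nonneg (sq_nonneg _) (hpn0 n s))
      (iBn n).aestronglyMeasurable]
    exact ENNReal.toReal_mono hB4n.ne (hBle n)
  have habs : ∀ s, |B s j * B s k| ≤ B s ⬝ᵥ B s := by
    intro s
    have hi : ∀ i, B s i ^ 2 ≤ B s ⬝ᵥ B s := by
      intro i
      rw [sq]
      exact Finset.single_le_sum (f := fun i => B s i * B s i)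
        (fun i _ => mul_self_nonneg _) (Finset.mem_univ i)
    have h1 := hi j
    have h2 := hi k
    rw [abs_le]
    constructor <;> nlinarith [sq_nonneg (B s j + B s k), sq_nonneg (B s j - B s k)]
  have hbb0 : ∀ s, 0 ≤ B s ⬝ᵥ B s := fun s => (abs_nonneg _).trans (habs s)
  -- integrability of f q
  have ifq : ∀ q : S → ℝ, Measurable q → (∀ s, 0 ≤ q s) → Integrable q μ →
      Integrable (fun s => (B s ⬝ᵥ B s) ^ 2 * q s) μ →
      Integrable (fun s => B s j * B s k * q s) μ := by
    intro q hq hq0 iq iBq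
    refine (iq.add iBq).mono' (((hBj j).mul (hBj k)).mul hq).aestronglyMeasurable
      (Eventually.of_forall fun s => ?_)
    rw [Real.norm_eq_abs, abs_mul, abs_of_nonneg (hq0 s)]
    have h1 : |B s j * B s k| ≤ 1 + (B s ⬝ᵥ B s) ^ 2 := by
      nlinarith [habs s, sq_nonneg ((B s ⬝ᵥ B s) - 1), hbb0 s]
    have := mul_le_mul_of_nonneg_right h1 (hq0 s)
    simp only [Pi.add_apply]
    linarith
  let D : ℕ → S → ℝ := fun n s => (Real.sqrt n * (Real.sqrt (pn n s) - Real.sqrt (p s)) -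
          (1 / 2) * g s * Real.sqrt (p s)) ^ 2
  have hDm : ∀ n, Measurable (D n) := by
    intro n
    have := hpn n
    fun_prop
  have iD : ∀ n, Integrable (D n) μ := by
    intro n
    refine (((ipn n).const_mul (3 * n)).add ((ip.const_mul (3 * n)).add ig)).mono'
      (hDm n).aestronglyMeasurable (Eventually.of_forall fun s => ?_)
    rw [Real.norm_eq_abs, abs_of_nonneg (sq_nonneg _)]
    simp only [Pi.add_apply, D]
    have h1 := Real.sq_sqrt (hpn0 n s)
    have h2 := Real.sq_sqrt (hp0 s)
    have h3 := Real.sq_sqrt (Nat.cast_nonneg (α := ℝ) n)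
    set a := √(pn n s)
    set b := √(p s)
    set c := √(n : ℝ)
    rw [← h1, ← h2, ← h3]
    nlinarith [sq_nonneg (c * a + c * b), sq_nonneg (c * a + 1 / 2 * g s * b),
      sq_nonneg (c * b - 1 / 2 * g s * b), sq_nonneg (g s * b)]
  have key : ∀ n : ℕ, 1 ≤ n → ∀ s, |B s j * B s k * pn n s - B s j * B s k * p s| ≤
      (√(n : ℝ))⁻¹ * ((B s ⬝ᵥ B s) ^ 2 * pn n s + (B s ⬝ᵥ B s) ^ 2 * p s + D n s
        + (g s) ^ 2 * p s) := by
    intro n hn s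
    have h1 := Real.sq_sqrt (hpn0 n s)
    have h2 := Real.sq_sqrt (hp0 s)
    have hc : 0 < √(n : ℝ) := Real.sqrt_pos.2 (by exact_mod_cast hn)
    have hf : (B s j * B s k) ^ 2 ≤ (B s ⬝ᵥ B s) ^ 2 := by
      rw [← sq_abs (B s j * B s k)]
      exact pow_le_pow_left₀ (abs_nonneg _) (habs s) 2
    have hF := mul_le_mul_of_nonneg_right hf (add_nonneg (hpn0 n s) (hp0 s))
    rw [inv_mul_eq_div, le_div_iff₀ hc]
    simp only [D]
    set a := √(pn n s)
    set b := √(p s)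
    set c := √(n : ℝ)
    set f := B s j * B s k
    set F := (B s ⬝ᵥ B s) ^ 2
    rw [← h1, ← h2] at hF ⊢
    have e : |f * a ^ 2 - f * b ^ 2| * c = |(f * (a + b)) * (c * (a - b))| := by
      rw [← abs_of_pos hc, ← abs_mul, abs_of_pos hc]
      congr 1
      ring
    rw [e]
    have y : |(f * (a + b)) * (c * (a - b))| ≤ ((f * (a + b)) ^ 2 + (c * (a - b)) ^ 2) / 2 := by
      rw [abs_le]
      constructor <;> nlinarith [sq_nonneg (f * (a + b) + c * (a - b)),
        sq_nonneg (f * (a + b) - c * (a - b))]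
    have y1 : (f * (a + b)) ^ 2 / 2 ≤ F * (a ^ 2 + b ^ 2) := by
      nlinarith [sq_nonneg (f * (a - b))]
    have y2 : (c * (a - b)) ^ 2 / 2 ≤ (c * (a - b) - 1 / 2 * g s * b) ^ 2 + g s ^ 2 * b ^ 2 := by
      nlinarith [sq_nonneg (c * (a - b) - 1 / 2 * g s * b - 1 / 2 * g s * b),
        sq_nonneg (g s * b)]
    linarith
  rw [tendsto_iff_norm_sub_tendsto_zero]
  have hlim : Tendsto (fun n : ℕ => (√(n : ℝ))⁻¹ * (M + ∫ s, (B s ⬝ᵥ B s) ^ 2 * p s ∂μ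
      + ∫ s, D n s ∂μ + ∫ s, (g s) ^ 2 * p s ∂μ)) atTop (𝓝 0) := by
    have h1 : Tendsto (fun n : ℕ => (√(n : ℝ))⁻¹) atTop (𝓝 0) :=
      tendsto_inv_atTop_zero.comp (Real.tendsto_sqrt_atTop.comp tendsto_natCast_atTop_atTop)
    have h2 := h1.mul (((tendsto_const_nhds (x := M + ∫ s, (B s ⬝ᵥ B s) ^ 2 * p s ∂μ)).add
      hdqm).add (tendsto_const_nhds (x := ∫ s, (g s) ^ 2 * p s ∂μ)))
    rw [zero_mul] at h2
    exact h2
  refine squeeze_zero' (Eventually.of_forall fun n => norm_nonneg _) ?_ hlim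
  filter_upwards [eventually_ge_atTop 1] with n hn
  rw [← integral_sub (ifq _ (hpn n) (hpn0 n) (ipn n) (iBn n)) (ifq _ hp hp0 ip iB)]
  have i1 := (iBn n).add iB
  have i2 := i1.add (iD n)
  have i3 := i2.add ig
  refine (norm_integral_le_of_norm_le (i3.const_mul (√(n : ℝ))⁻¹)
    (Eventually.of_forall fun s => key n hn s)).trans ?_
  rw [integral_const_mul, integral_add' i2 ig, integral_add' i1 (iD n), integral_add' (iBn n) iB]
  have := hM n
  gcongr
end
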